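/- Let n ≥ 6 and let ρ be a C¹ action of Aut(F_n), the automorphism group of the free group F_n on n generators, on the circle. Then ρ factors through an action of ℤ/2ℤ: the kernel of ρ is a subgroup of Aut(F_n) of index at most 2. -/

import Mathlib

open MeasureTheory

/-- The group of self-homeomorphisms of the circle `S¹ = ℝ/ℤ`,
with `f * g = f ∘ g`. -/
noncomputable instance : Group (UnitAddCircle ≃ₜ UnitAddCircle) where
  mul f g := g.trans f
  one := Homeomorph.refl _
  inv := Homeomorph.symm
  mul_assoc _ _ _ := Homeomorph.ext fun _ => rfl
  one_mul _ := Homeomorph.ext fun _ => rfl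
  mul_one _ := Homeomorph.ext fun _ => rfl
  inv_mul_cancel a := Homeomorph.ext a.symm_apply_apply

/-- `F : ℝ → ℝ` is a `C¹` lift of the circle homeomorphism `f`: it is `C¹` with
nowhere-vanishing derivative, commutes with the deck transformation up to sign,
and descends to `f` on `ℝ/ℤ`. -/
def IsC1Lift (f : UnitAddCircle ≃ₜ UnitAddCircle) (F : ℝ → ℝ) : Prop :=
  ContDiff ℝ 1 F ∧ (∀ x : ℝ, deriv F x ≠ 0) ∧
    ((∀ x : ℝ, F (x + 1) = F x + 1) ∨ (∀ x : ℝ, F (x + 1) = F x - 1)) ∧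
    ∀ x : ℝ, f (x : UnitAddCircle) = ((F x : ℝ) : UnitAddCircle)

/-- A `C¹` action of a group `Γ` on the circle: a homomorphism into the
self-homeomorphisms of the circle all of whose values admit `C¹` lifts. -/
def IsC1Action {Γ : Type*} [Group Γ] (ρ : Γ →* (UnitAddCircle ≃ₜ UnitAddCircle)) : Prop :=
  ∀ γ : Γ, ∃ F : ℝ → ℝ, IsC1Lift (ρ γ) F

/-- `F : ℝ → ℝ` is an orientation-preserving `C¹` lift of the circle
homeomorphism `f`: it is `C¹` with everywhere positive derivative,
satisfies `F (x+1) = F x + 1` and descends to `f` on `ℝ/ℤ`. -/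
def IsOPC1Lift (f : UnitAddCircle ≃ₜ UnitAddCircle) (F : ℝ → ℝ) : Prop :=
  ContDiff ℝ 1 F ∧ (∀ x : ℝ, 0 < deriv F x) ∧
    (∀ x : ℝ, F (x + 1) = F x + 1) ∧
    ∀ x : ℝ, f (x : UnitAddCircle) = ((F x : ℝ) : UnitAddCircle)

/-- `F : ℝ → ℝ` is an orientation-preserving (topological) lift of the circle
homeomorphism `f`: continuous, strictly increasing, satisfies
`F (x+1) = F x + 1`, and descends to `f` on `ℝ/ℤ`. -/
def IsOPLift (f : UnitAddCircle ≃ₜ UnitAddCircle) (F : ℝ → ℝ) : Prop :=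
  Continuous F ∧ StrictMono F ∧
    (∀ x : ℝ, F (x + 1) = F x + 1) ∧
    ∀ x : ℝ, f (x : UnitAddCircle) = ((F x : ℝ) : UnitAddCircle)

/-! ### Finite groups of orientation-preserving circle homeomorphisms -/

section Circle

lemma IsOPLift.mul {f g : UnitAddCircle ≃ₜ UnitAddCircle} {F G : ℝ → ℝ}
    (hF : IsOPLift f F) (hG : IsOPLift g G) : IsOPLift (f * g) (F ∘ G) := by
  refine ⟨hF.1.comp hG.1, hF.2.1.comp hG.2.1, fun x => ?_, fun x => ?_⟩
  · simp only [Function.comp, hG.2.2.1, hF.2.2.1]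
  · change f (g x) = _
    rw [hG.2.2.2, hF.2.2.2]
    rfl

lemma isOPLift_one : IsOPLift 1 id :=
  ⟨continuous_id, strictMono_id, fun _ => rfl, fun _ => rfl⟩

/-- Two lifts of the same circle homeomorphism differ by a constant. -/
lemma IsOPLift.exists_eq_add {f : UnitAddCircle ≃ₜ UnitAddCircle} {F G : ℝ → ℝ}
    (hF : IsOPLift f F) (hG : IsOPLift f G) : ∃ c : ℝ, ∀ x, F x = G x + c := by
  have h : ∀ x, ∃ m : ℤ, (m : ℝ) = F x - G x := by
    intro x
    have h1 : ((F x : ℝ) : UnitAddCircle) = ((G x : ℝ) : UnitAddCircle) := by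
      rw [← hF.2.2.2, ← hG.2.2.2]
    obtain ⟨m, hm⟩ := AddSubgroup.mem_zmultiples_iff.1 ((QuotientAddGroup.eq_iff_sub_mem).1 h1)
    exact ⟨m, by simpa using hm⟩
  choose m hm using h
  have hc : Continuous m := by
    rw [Int.isClosedEmbedding_coe_real.isEmbedding.continuous_iff]
    have : ((↑) : ℤ → ℝ) ∘ m = fun x => F x - G x := funext hm
    rw [this]
    exact hF.1.sub hG.1
  refine ⟨m 0, fun x => ?_⟩
  have : m x = m 0 := PreconnectedSpace.constant inferInstance hc
  rw [← this, hm]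
  ring

/-- A finite group acting on the circle by orientation-preserving homeomorphisms
acts through an abelian quotient: averaging lifts conjugates it to a group of translations. -/
lemma map_mul_comm_of_isOPLift {G : Type*} [Group G] [Finite G]
    (σ : G →* (UnitAddCircle ≃ₜ UnitAddCircle)) (h : ∀ g, ∃ F, IsOPLift (σ g) F) (a b : G) :
    σ a * σ b = σ b * σ a := by
  have := Fintype.ofFinite G
  choose F hF using h
  set H : ℝ → ℝ := fun x => ∑ g, F g x with hH
  have hmono : StrictMono H := fun x y hxy =>
    Finset.sum_lt_sum_of_nonempty ⟨1, Finset.mem_univ _⟩ fun g _ => (hF g).2.1 hxy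
  have key : ∀ k, ∃ c, ∀ x, H (F k x) = H x + c := by
    intro k
    have : ∀ g, ∃ c : ℝ, ∀ x, F g (F k x) = F (g * k) x + c := fun g => by
      have h1 := (hF g).mul (hF k)
      rw [← map_mul] at h1
      exact h1.exists_eq_add (hF (g * k))
    choose c hc using this
    refine ⟨∑ g, c g, fun x => ?_⟩
    simp only [hH, hc, Finset.sum_add_distrib]
    rw [Fintype.sum_equiv (Equiv.mulRight k) (fun g => F (g * k) x) (fun g => F g x)
      fun _ => rfl]
  obtain ⟨c, hc⟩ := key a
  obtain ⟨d, hd⟩ := key b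
  refine Homeomorph.ext fun x => ?_
  obtain ⟨x, rfl⟩ := QuotientAddGroup.mk_surjective x
  have e : F a (F b x) = F b (F a x) := hmono.injective (by rw [hc, hd, hd, hc]; ring)
  change σ a (σ b (x : UnitAddCircle)) = σ b (σ a (x : UnitAddCircle))
  rw [(hF b).2.2.2, (hF a).2.2.2, (hF a).2.2.2, (hF b).2.2.2, e]

/-- The square of a circle homeomorphism with a `C¹` lift preserves orientation. -/
lemma IsC1Lift.isOPLift_mul_self {f : UnitAddCircle ≃ₜ UnitAddCircle} {F : ℝ → ℝ}
    (h : IsC1Lift f F) : IsOPLift (f * f) (F ∘ F) := by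
  obtain ⟨hF, -, hd, hl⟩ := h
  have hint : ∀ (x : ℝ) (m : ℤ), F (x + m) = F x → m = 0 := by
    rcases hd with hd | hd
    · have : ∀ (m : ℤ) (x : ℝ), F (x + m) = F x + m := by
        intro m
        induction m using Int.induction_on with
        | zero => simp
        | succ k ih => intro x; push_cast at ih ⊢; rw [← add_assoc, hd, ih]; ring
        | pred k ih =>
          intro x
          have h1 := hd (x + ((-k - 1 : ℤ) : ℝ))
          have h2 := ih x
          push_cast at h1 h2 ⊢
          rw [show x + (-(k : ℝ) - 1) + 1 = x + -k by ring] at h1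
          linarith
      intro x m hm
      rw [this] at hm
      exact_mod_cast (add_eq_left.1 hm)
    · have : ∀ (m : ℤ) (x : ℝ), F (x + m) = F x - m := by
        intro m
        induction m using Int.induction_on with
        | zero => simp
        | succ k ih => intro x; push_cast at ih ⊢; rw [← add_assoc, hd, ih]; ring
        | pred k ih =>
          intro x
          have h1 := hd (x + ((-k - 1 : ℤ) : ℝ))
          have h2 := ih x
          push_cast at h1 h2 ⊢
          rw [show x + (-(k : ℝ) - 1) + 1 = x + -k by ring] at h1
          linarith
      intro x m hm
      rw [this] at hm
      exact_mod_cast (sub_eq_self.1 hm)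
  have hinj : Function.Injective F := by
    intro x y hxy
    have h1 : (y : UnitAddCircle) = (x : UnitAddCircle) := f.injective (by rw [hl, hl, hxy])
    obtain ⟨m, hm⟩ := AddSubgroup.mem_zmultiples_iff.1 ((QuotientAddGroup.eq_iff_sub_mem).1 h1)
    have hy : y = x + m := by
      have : (m : ℝ) = y - x := by simpa using hm
      linarith
    rw [hy] at hxy ⊢
    rw [hint x m hxy.symm]
    simp
  have hmono : StrictMono (F ∘ F) := by
    rcases hF.continuous.strictMono_of_inj hinj with h | h
    · exact h.comp h
    · exact h.comp h
  refine ⟨hF.continuous.comp hF.continuous, hmono, fun x => ?_, fun x => ?_⟩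
  · rcases hd with hd | hd
    · simp only [Function.comp, hd]
    · have := hd (F x - 1)
      simp only [Function.comp, hd, sub_add_cancel] at this ⊢
      linarith
  · change f (f x) = _
    rw [hl, hl]
    rfl

/-- A `C¹` action on the circle of a finite symmetric group of degree at least `5` kills the
alternating group. -/
lemma IsC1Action.map_eq_one_of_mem_alternatingGroup {α : Type*} [Fintype α] [DecidableEq α]
    (hα : 5 ≤ Nat.card α) {ρ : Equiv.Perm α →* (UnitAddCircle ≃ₜ UnitAddCircle)}
    (hρ : IsC1Action ρ) {g : Equiv.Perm α} (hg : g ∈ alternatingGroup α) : ρ g = 1 := by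
  have hpow : ∀ x, (∃ F, IsOPLift (ρ x) F) → ∀ k : ℕ, ∃ F, IsOPLift (ρ (x ^ k)) F := by
    rintro x ⟨F, hF⟩ k
    induction k with
    | zero => exact ⟨id, by simpa using isOPLift_one⟩
    | succ k ih =>
      obtain ⟨G, hG⟩ := ih
      exact ⟨_, by rw [pow_succ, map_mul]; exact hG.mul hF⟩
  have hop : ∀ x ∈ alternatingGroup α, ∃ F, IsOPLift (ρ x) F := by
    intro x hx
    rw [← Equiv.Perm.closure_three_cycles_eq_alternating] at hx
    induction hx using Subgroup.closure_induction with
    | mem x hx =>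
      obtain ⟨F, hF⟩ := hρ (x ^ 2)
      refine ⟨F ∘ F, ?_⟩
      have : x = x ^ 2 * x ^ 2 := by
        have h3 : x ^ 3 = 1 := by rw [← hx.orderOf, pow_orderOf_eq_one]
        rw [← pow_add, pow_succ, h3, one_mul]
      rw [this, map_mul]
      exact hF.isOPLift_mul_self
    | one => exact ⟨id, by simpa using isOPLift_one⟩
    | mul x y _ _ hx hy =>
      obtain ⟨F, hF⟩ := hx
      obtain ⟨G, hG⟩ := hy
      exact ⟨_, by rw [map_mul]; exact hF.mul hG⟩
    | inv x _ hx =>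
      have : x⁻¹ = x ^ (orderOf x - 1) := by
        rw [inv_eq_iff_mul_eq_one, ← pow_succ', Nat.sub_add_cancel (orderOf_pos x),
          pow_orderOf_eq_one]
      rw [this]
      exact hpow x hx _
  let σ := ρ.comp (alternatingGroup α).subtype
  have hcomm := map_mul_comm_of_isOPLift σ fun x => hop x x.2
  have hker : commutator (alternatingGroup α) ≤ σ.ker := by
    rw [commutator_def, Subgroup.commutator_le]
    intro a _ b _
    rw [MonoidHom.mem_ker, map_commutatorElement, commutatorElement_eq_one_iff_mul_comm]
    exact hcomm a b
  rw [commutator_alternatingGroup_eq_top hα] at hker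
  exact hker (Subgroup.mem_top ⟨g, hg⟩)

end Circle

/-! ### Common prefixes and codes of lists -/

section Lists

variable {β : Type*}

/-- The length of the longest common prefix of two lists. -/
def List.commonPrefixLength [DecidableEq β] : List β → List β → ℕ
  | a :: l, b :: m => if a = b then commonPrefixLength l m + 1 else 0
  | _, _ => 0

namespace List

section CommonPrefix

variable [DecidableEq β]

@[simp] lemma commonPrefixLength_nil_left (l : List β) : commonPrefixLength [] l = 0 := by
  cases l <;> rfl

@[simp] lemma commonPrefixLength_nil_right (l : List β) : commonPrefixLength l [] = 0 := by
  cases l <;> rfl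

lemma commonPrefixLength_cons (a b : β) (l m : List β) :
    commonPrefixLength (a :: l) (b :: m) = if a = b then commonPrefixLength l m + 1 else 0 := rfl

lemma commonPrefixLength_comm (l m : List β) :
    commonPrefixLength l m = commonPrefixLength m l := by
  induction l generalizing m with
  | nil => simp
  | cons a l ih =>
    cases m with
    | nil => simp
    | cons b m => simp only [commonPrefixLength_cons, ih m, eq_comm]

lemma exists_eq_append_of_commonPrefixLength (l m : List β) :
    ∃ p a b, l = p ++ a ∧ m = p ++ b ∧ p.length = commonPrefixLength l m ∧
      ∀ x ∈ a.head?, ∀ y ∈ b.head?, x ≠ y := by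
  induction l generalizing m with
  | nil => exact ⟨[], [], m, by simp⟩
  | cons a l ih =>
    cases m with
    | nil => exact ⟨[], a :: l, [], by simp⟩
    | cons b m =>
      by_cases h : a = b
      · subst h
        obtain ⟨p, x, y, rfl, rfl, hp, hxy⟩ := ih m
        exact ⟨a :: p, x, y, rfl, rfl, by simp [commonPrefixLength_cons, hp], hxy⟩
      · exact ⟨[], a :: l, b :: m, rfl, rfl, by simp [commonPrefixLength_cons, h], by simpa using h⟩

lemma min_commonPrefixLength_le (l m k : List β) :
    min (commonPrefixLength l m) (commonPrefixLength m k) ≤ commonPrefixLength l k := by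
  induction l generalizing m k with
  | nil => simp
  | cons a l ih =>
    cases m with
    | nil => simp
    | cons b m =>
      cases k with
      | nil => simp
      | cons c k =>
        have := ih m k
        simp only [commonPrefixLength_cons]
        split_ifs <;> simp_all

lemma le_commonPrefixLength {l m : List β} {k : ℕ} (hk : k ≤ l.length)
    (h : l.take k = m.take k) : k ≤ commonPrefixLength l m := by
  induction k generalizing l m with
  | zero => simp
  | succ k ih =>
    cases l with
    | nil => simp at hk
    | cons a l =>
      cases m with
      | nil => simp at h
      | cons b m =>
        simp only [List.take_succ_cons, List.cons.injEq] at h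
        simpa [commonPrefixLength_cons, h.1] using ih (by simpa using hk) h.2

lemma commonPrefixLength_eq_of_lt {l m k : List β}
    (h : commonPrefixLength l m < commonPrefixLength m k) :
    commonPrefixLength l k = commonPrefixLength l m := by
  have h1 := min_commonPrefixLength_le l m k
  have h2 := min_commonPrefixLength_le l k m
  rw [commonPrefixLength_comm k m] at h2
  omega

end CommonPrefix

/-- A numerical code of the words over a finite alphabet. -/
noncomputable def code [Fintype β] (l : List β) : ℕ :=
  Nat.ofDigits (Fintype.card β + 2) (l.map fun b => (Fintype.equivFin β b : ℕ))

lemma code_injective_of_length_eq [Fintype β] {p q : List β} (h : p.length = q.length)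
    (hc : p.code = q.code) : p = q := by
  have hb : ∀ l : List β, ∀ d ∈ l.map fun b => (Fintype.equivFin β b : ℕ),
      d < Fintype.card β + 2 := by
    intro l d hd
    obtain ⟨b, -, rfl⟩ := List.mem_map.1 hd
    have := (Fintype.equivFin β b).2
    omega
  have := Nat.ofDigits_inj_of_len_eq (by omega) (by simpa using h) (hb p) (hb q) hc
  exact List.map_injective_iff.2 (Fin.val_injective.comp (Fintype.equivFin β).injective) this

lemma code_append_lt [Fintype β] {p q : List β} (h : q.length = p.length)
    (hc : q.code < p.code) (a : List β) : (q ++ a).code < (p ++ a).code := by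
  simp only [code, List.map_append, Nat.ofDigits_append, List.length_map, h] at hc ⊢
  omega

end List

end Lists

/-! ### Elementary automorphisms of a free group -/

namespace FreeGroup

variable {α : Type*}

/-- The inverse of a letter. -/
def invLetter (s : α × Bool) : α × Bool := (s.1, !s.2)

@[simp] lemma invLetter_fst (s : α × Bool) : (invLetter s).1 = s.1 := rfl

@[simp] lemma invLetter_invLetter (s : α × Bool) : invLetter (invLetter s) = s := by
  simp [invLetter]

lemma invLetter_ne (s : α × Bool) : invLetter s ≠ s := by
  obtain ⟨a, b⟩ := s
  cases b <;> simp [invLetter]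

lemma eq_or_eq_invLetter {s t : α × Bool} (h : s.1 = t.1) : s = t ∨ s = invLetter t := by
  obtain ⟨a, b⟩ := s
  obtain ⟨c, d⟩ := t
  cases b <;> cases d <;> simp_all [invLetter]

/-- The element of the free group given by a letter. -/
def ofLetter (s : α × Bool) : FreeGroup α := mk [s]

lemma ofLetter_true (a : α) : ofLetter (a, true) = of a := rfl

lemma ofLetter_false (a : α) : ofLetter (a, false) = (of a)⁻¹ := rfl

@[simp] lemma ofLetter_invLetter (s : α × Bool) : ofLetter (invLetter s) = (ofLetter s)⁻¹ := by
  simp [ofLetter, inv_mk, invRev, invLetter]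

lemma ofLetter_injective : Function.Injective (ofLetter : α × Bool → FreeGroup α) := by
  classical
  intro s t h
  have := congrArg toWord h
  simpa [ofLetter, reduce_singleton] using this

lemma hom_ext_ofLetter {f g : FreeGroup α →* FreeGroup α}
    (h : ∀ a, ∃ b, f (ofLetter (a, b)) = g (ofLetter (a, b))) : f = g := by
  refine ext_hom _ _ fun a => ?_
  obtain ⟨b, hb⟩ := h a
  cases b
  · simpa [ofLetter_false] using hb
  · exact hb

lemma mulAut_ext {f g : MulAut (FreeGroup α)}
    (h : ∀ a, ∃ b, f (ofLetter (a, b)) = g (ofLetter (a, b))) : f = g :=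
  MulEquiv.toMonoidHom_injective (hom_ext_ofLetter h)

section SignChange

/-- The endomorphism sending the generator `a` to `a` or `a⁻¹` according to `ε a`. -/
def signChangeHom (ε : α → Bool) : FreeGroup α →* FreeGroup α := lift fun a => ofLetter (a, ε a)

lemma signChangeHom_ofLetter (ε : α → Bool) (s : α × Bool) :
    signChangeHom ε (ofLetter s) = ofLetter (s.1, s.2 == ε s.1) := by
  obtain ⟨a, b⟩ := s
  cases b <;> cases h : ε a <;> simp [signChangeHom, ofLetter_true, ofLetter_false, h]

lemma signChangeHom_comp_self (ε : α → Bool) :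
    (signChangeHom ε).comp (signChangeHom ε) = MonoidHom.id _ := by
  refine ext_hom _ _ fun a => ?_
  rw [← ofLetter_true, MonoidHom.comp_apply, signChangeHom_ofLetter, signChangeHom_ofLetter]
  cases ε a <;> rfl

/-- The automorphism sending the generator `a` to `a` or `a⁻¹` according to `ε a`. -/
def signChange (ε : α → Bool) : MulAut (FreeGroup α) :=
  MonoidHom.toMulEquiv (signChangeHom ε) (signChangeHom ε) (signChangeHom_comp_self ε)
    (signChangeHom_comp_self ε)

lemma signChange_ofLetter (ε : α → Bool) (s : α × Bool) :
    signChange ε (ofLetter s) = ofLetter (s.1, s.2 == ε s.1) := signChangeHom_ofLetter ε s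

/-- The automorphism inverting a single generator. -/
def inversion [DecidableEq α] (i : α) : MulAut (FreeGroup α) := signChange fun a => decide (a ≠ i)

lemma inversion_ofLetter_self [DecidableEq α] (i : α) (b : Bool) :
    inversion i (ofLetter (i, b)) = ofLetter (i, !b) := by
  rw [inversion, signChange_ofLetter]
  simp

lemma inversion_ofLetter_of_ne [DecidableEq α] {i : α} {s : α × Bool} (h : s.1 ≠ i) :
    inversion i (ofLetter s) = ofLetter s := by
  rw [inversion, signChange_ofLetter]
  simp [h]

end SignChange

section Permutation

/-- The action of permutations of the generators on a free group. -/
def permAut : Equiv.Perm α →* MulAut (FreeGroup α) where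
  toFun := freeGroupCongr
  map_one' := freeGroupCongr_refl
  map_mul' σ τ := (freeGroupCongr_trans τ σ).symm

lemma permAut_ofLetter (σ : Equiv.Perm α) (s : α × Bool) :
    permAut σ (ofLetter s) = ofLetter (σ s.1, s.2) := rfl

end Permutation

section Transvection

variable [DecidableEq α]

/-- The endomorphism sending the letter `t` to `s * t` and fixing the generators other than
that of `t`. -/
def transvectionHom (t s : α × Bool) : FreeGroup α →* FreeGroup α :=
  lift fun a => if a = t.1 then (bif t.2 then ofLetter s * of a else of a * (ofLetter s)⁻¹)
    else of a

lemma transvectionHom_self (t s : α × Bool) :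
    transvectionHom t s (ofLetter t) = ofLetter s * ofLetter t := by
  obtain ⟨a, b⟩ := t
  cases b <;> simp [transvectionHom, ofLetter_true, ofLetter_false]

lemma transvectionHom_of_ne {t r : α × Bool} (s : α × Bool) (h : r.1 ≠ t.1) :
    transvectionHom t s (ofLetter r) = ofLetter r := by
  obtain ⟨a, b⟩ := r
  cases b <;> simp_all [transvectionHom, ofLetter_true, ofLetter_false]

lemma transvectionHom_comp_invLetter {t s : α × Bool} (h : t.1 ≠ s.1) :
    (transvectionHom t s).comp (transvectionHom t (invLetter s)) = MonoidHom.id _ := by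
  refine hom_ext_ofLetter fun a => ?_
  by_cases ha : a = t.1
  · subst ha
    refine ⟨t.2, ?_⟩
    simp [transvectionHom_self, transvectionHom_of_ne s h.symm]
  · refine ⟨true, ?_⟩
    have : ((a, true) : α × Bool).1 ≠ t.1 := ha
    simp [transvectionHom_of_ne _ this]

/-- The transvection sending the letter `t` to `s * t` and fixing the generators other than
that of `t`. -/
def transvection (t s : α × Bool) (h : t.1 ≠ s.1) : MulAut (FreeGroup α) :=
  MonoidHom.toMulEquiv (transvectionHom t s) (transvectionHom t (invLetter s))
    (by simpa using transvectionHom_comp_invLetter (s := invLetter s) h)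
    (transvectionHom_comp_invLetter h)

variable {t s : α × Bool} (h : t.1 ≠ s.1)

lemma transvection_self : transvection t s h (ofLetter t) = ofLetter s * ofLetter t :=
  transvectionHom_self t s

lemma transvection_of_ne {r : α × Bool} (hr : r.1 ≠ t.1) :
    transvection t s h (ofLetter r) = ofLetter r :=
  transvectionHom_of_ne s hr

end Transvection

end FreeGroup

/-! ### Nielsen's theorem: generation of the automorphism group of a free group -/

namespace FreeGroup

section Length

variable {α : Type*}

lemma mem_getLast?_invRev {L : List (α × Bool)} {x : α × Bool} (h : x ∈ (invRev L).getLast?) :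
    invLetter x ∈ L.head? := by
  cases L with
  | nil => simp [invRev] at h
  | cons a L =>
    simp only [invRev, List.map_cons, List.reverse_cons, List.getLast?_append,
      List.getLast?_singleton, Option.some_or, Option.mem_def, Option.some.injEq] at h
    simp [invLetter, ← h]

variable [DecidableEq α]

lemma isReduced_invRev {L : List (α × Bool)} (h : IsReduced L) : IsReduced (invRev L) := by
  rw [isReduced_iff_reduce_eq] at h ⊢
  rw [reduce_invRev, h]

/-- The Gromov product formula: the norm of `u⁻¹ * v` in terms of the common prefix. -/
lemma norm_inv_mul (u v : FreeGroup α) :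
    norm (u⁻¹ * v) + 2 * u.toWord.commonPrefixLength v.toWord = norm u + norm v := by
  obtain ⟨p, a, b, hu, hv, hp, hab⟩ := u.toWord.exists_eq_append_of_commonPrefixLength v.toWord
  have ha : IsReduced a := (List.isChain_append.1 (hu ▸ isReduced_toWord (x := u))).2.1
  have hb : IsReduced b := (List.isChain_append.1 (hv ▸ isReduced_toWord (x := v))).2.1
  have hred : IsReduced (invRev a ++ b) := by
    refine List.isChain_append.2 ⟨isReduced_invRev ha, hb, fun x hx y hy hxy => ?_⟩
    have h1 := hab _ (mem_getLast?_invRev hx) y hy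
    rcases eq_or_eq_invLetter hxy with h | h
    · rw [h]
    · exact absurd (by rw [h, invLetter_invLetter]) h1
  have hmul : u⁻¹ * v = mk (invRev a ++ b) := by
    rw [← mk_toWord (x := u), ← mk_toWord (x := v), hu, hv, ← mul_mk, ← mul_mk, ← mul_mk, ← inv_mk]
    group
  rw [hmul, norm, toWord_mk, hred.reduce_eq, ← hp, norm, norm, hu, hv]
  simp only [List.length_append, invRev_length]
  omega

lemma two_mul_commonPrefixLength_inv_lt {u : FreeGroup α} (hu : u ≠ 1) :
    2 * u⁻¹.toWord.commonPrefixLength u.toWord < norm u := by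
  by_contra! hle
  obtain ⟨p, a, b, h1, h2, hp, -⟩ := u⁻¹.toWord.exists_eq_append_of_commonPrefixLength u.toWord
  have hlen : 0 < u.toWord.length := Nat.pos_of_ne_zero fun h => hu (norm_eq_zero.1 h)
  rw [← hp, norm] at hle
  have hpl : p.length ≤ u.toWord.length := by simp [h2]
  have key : ∀ i (hi : i < p.length),
      u.toWord[i] = invLetter u.toWord[u.toWord.length - 1 - i] := by
    intro i hi
    have e1 : u.toWord[i] = p[i] := by simp [h2, List.getElem_append_left hi]
    have hi' : i < u⁻¹.toWord.length := by rw [h1, List.length_append]; omega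
    have e2 : u⁻¹.toWord[i] = p[i] := by simp [h1, List.getElem_append_left hi]
    rw [e1, ← e2]
    simp [toWord_inv, invRev, invLetter]
  have hi : (u.toWord.length - 1) / 2 < p.length := by omega
  have h3 := key _ hi
  rcases Nat.even_or_odd' u.toWord.length with ⟨m, hm | hm⟩
  · have hred : IsReduced u.toWord := isReduced_toWord
    have h4 := List.isChain_iff_getElem.1 hred (m - 1) (by omega)
    have e1 : (u.toWord.length - 1) / 2 = m - 1 := by omega
    have e2 : u.toWord.length - 1 - (u.toWord.length - 1) / 2 = m - 1 + 1 := by omega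
    simp only [e2] at h3
    simp only [e1] at h3
    rw [h3] at h4
    simp [invLetter] at h4
  · have e : u.toWord.length - 1 - (u.toWord.length - 1) / 2 = (u.toWord.length - 1) / 2 := by omega
    simp only [e] at h3
    exact invLetter_ne _ h3.symm

end Length

section HalfCode

variable {α : Type*} [Fintype α] [DecidableEq α]

/-- The code of the left half of a reduced word. -/
noncomputable def halfCode (u : FreeGroup α) : ℕ := (u.toWord.take ((norm u + 1) / 2)).code

lemma halfCode_lt {u v : FreeGroup α} {p q a : List (α × Bool)} (hu : u.toWord = p ++ a)
    (hv : v.toWord = q ++ a) (hpq : q.length = p.length) (hpa : p.length ≤ a.length)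
    (hc : q.code < p.code) : halfCode v < halfCode u := by
  have h : norm v = norm u := by simp [norm, hu, hv, hpq]
  have h2 : norm u = p.length + a.length := by simp [norm, hu]
  rw [halfCode, halfCode, h, hu, hv, List.take_append, List.take_append,
    List.take_of_length_le (l := q) (by omega), List.take_of_length_le (l := p) (by omega), hpq]
  exact List.code_append_lt hpq hc _

lemma halfCode_inv_eq {u v : FreeGroup α} {p q a : List (α × Bool)} (hu : u.toWord = p ++ a)
    (hv : v.toWord = q ++ a) (hpq : q.length = p.length) (hpa : p.length ≤ a.length) :
    halfCode v⁻¹ = halfCode u⁻¹ := by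
  have h : norm v = norm u := by simp [norm, hu, hv, hpq]
  have h2 : norm u = p.length + a.length := by simp [norm, hu]
  have h3 : (invRev a).length = a.length := invRev_length
  rw [halfCode, halfCode, norm_inv_eq, norm_inv_eq, h, toWord_inv, toWord_inv, hu, hv,
    invRev_append, invRev_append, List.take_append_of_le_length (by omega),
    List.take_append_of_le_length (by omega)]

end HalfCode

section NielsenReduced

variable {α : Type*} [DecidableEq α]

/-- The length of the common prefix of the images of two letters. -/
def prefixLength (φ : MulAut (FreeGroup α)) (s t : α × Bool) : ℕ :=
  (φ (ofLetter s)).toWord.commonPrefixLength (φ (ofLetter t)).toWord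

lemma prefixLength_comm (φ : MulAut (FreeGroup α)) (s t : α × Bool) :
    prefixLength φ s t = prefixLength φ t s := List.commonPrefixLength_comm _ _

/-- An automorphism is Nielsen reduced if the images of the generators form a Nielsen reduced
basis: at most half of every image cancels on each side, and something remains of every image
after cancellation on both sides. -/
structure IsNielsenReduced (φ : MulAut (FreeGroup α)) : Prop where
  two_mul_prefixLength_le : ∀ ⦃s t⦄, s ≠ t → 2 * prefixLength φ s t ≤ norm (φ (ofLetter s))
  prefixLength_add_lt : ∀ ⦃r s t⦄, r ≠ s → t ≠ invLetter s →
    prefixLength φ r s + prefixLength φ (invLetter s) t < norm (φ (ofLetter s))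

lemma ofLetter_ne_one (s : α × Bool) : ofLetter s ≠ 1 := by
  intro h
  have := congrArg toWord h
  simp [ofLetter] at this

lemma norm_map_ofLetter_pos (φ : MulAut (FreeGroup α)) (s : α × Bool) :
    0 < norm (φ (ofLetter s)) := by
  refine Nat.pos_of_ne_zero fun h => ofLetter_ne_one s ?_
  simpa using norm_eq_zero.1 h

lemma IsNielsenReduced.prefix_and_norm {φ : MulAut (FreeGroup α)} (hφ : IsNielsenReduced φ)
    (L : List (α × Bool)) (s : α × Bool) (hL : IsReduced (s :: L)) (r : α × Bool) (hr : r ≠ s) :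
    (φ (ofLetter r)).toWord.commonPrefixLength (φ (FreeGroup.mk (s :: L))).toWord =
        prefixLength φ r s ∧
      prefixLength φ r s + (L.length + 1) ≤ norm (φ (FreeGroup.mk (s :: L))) := by
  induction L generalizing s r with
  | nil =>
    refine ⟨rfl, ?_⟩
    have h1 := hφ.two_mul_prefixLength_le hr.symm
    have h2 := norm_map_ofLetter_pos φ s
    rw [prefixLength_comm] at h1
    change _ ≤ norm (φ (ofLetter s))
    simp only [List.length_nil]
    omega
  | cons t L ih =>
    have hts : invLetter s ≠ t := by
      rintro rfl
      have := (isReduced_cons_cons.1 hL).1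
      simp [invLetter] at this
    have hw : FreeGroup.mk (s :: t :: L) = ofLetter s * FreeGroup.mk (t :: L) := by
      simp [ofLetter, mul_mk]
    obtain ⟨h1, h2⟩ := ih t (isReduced_cons_cons.1 hL).2 (invLetter s) hts
    have h3 := norm_inv_mul (φ (ofLetter (invLetter s))) (φ (FreeGroup.mk (t :: L)))
    have h4 := norm_inv_mul (φ (ofLetter s)) (φ (FreeGroup.mk (s :: t :: L)))
    have e1 : (φ (ofLetter (invLetter s)))⁻¹ * φ (FreeGroup.mk (t :: L)) =
        φ (FreeGroup.mk (s :: t :: L)) := by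
      simp [hw]
    have e2 : (φ (ofLetter s))⁻¹ * φ (FreeGroup.mk (s :: t :: L)) = φ (FreeGroup.mk (t :: L)) := by
      simp [hw]
    have e3 : norm (φ (ofLetter (invLetter s))) = norm (φ (ofLetter s)) := by simp
    rw [e1, h1, e3] at h3
    rw [e2] at h4
    have h5 := hφ.prefixLength_add_lt hr hts.symm
    have h6 : (φ (ofLetter r)).toWord.commonPrefixLength (φ (FreeGroup.mk (s :: t :: L))).toWord =
        prefixLength φ r s := by
      refine List.commonPrefixLength_eq_of_lt (?_ : prefixLength φ r s < _)
      omega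
    refine ⟨h6, ?_⟩
    simp only [List.length_cons] at h2 ⊢
    omega

lemma IsNielsenReduced.norm_le {φ : MulAut (FreeGroup α)} (hφ : IsNielsenReduced φ)
    (x : FreeGroup α) : norm x ≤ norm (φ x) := by
  have hx : IsReduced x.toWord := isReduced_toWord
  rw [← mk_toWord (x := x)]
  generalize x.toWord = L at hx
  cases L with
  | nil => simp [← one_eq_mk]
  | cons s L =>
    have := (hφ.prefix_and_norm L s hx (invLetter s) (invLetter_ne s)).2
    rw [norm, toWord_mk, hx.reduce_eq, List.length_cons]
    omega

/-- The inverse of a Nielsen reduced automorphism maps generators to letters. -/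
lemma IsNielsenReduced.exists_inv_apply_eq {φ : MulAut (FreeGroup α)} (hφ : IsNielsenReduced φ)
    (a : α) : ∃ s, φ⁻¹ (of a) = ofLetter s := by
  have h1 := hφ.norm_le (φ⁻¹ (of a))
  rw [MulAut.apply_inv_self, norm_of, norm] at h1
  rcases h : (φ⁻¹ (of a)).toWord with _ | ⟨s, _ | ⟨t, L⟩⟩
  · rw [toWord_eq_nil_iff, map_eq_one_iff _ (φ⁻¹).injective] at h
    exact absurd h (of_ne_one a)
  · exact ⟨s, by rw [← mk_toWord (x := φ⁻¹ (of a)), h]; rfl⟩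
  · rw [h] at h1
    simp at h1

end NielsenReduced

section Descent

variable {α : Type*} [DecidableEq α]

lemma mul_transvection_self (φ : MulAut (FreeGroup α)) {t s : α × Bool} (h : t.1 ≠ s.1) :
    (φ * transvection t s h) (ofLetter t) = φ (ofLetter s) * φ (ofLetter t) := by
  rw [MulAut.mul_apply, transvection_self, _root_.map_mul]

lemma mul_transvection_of_ne (φ : MulAut (FreeGroup α)) {t s r : α × Bool} (h : t.1 ≠ s.1)
    (hr : r.1 ≠ t.1) : (φ * transvection t s h) (ofLetter r) = φ (ofLetter r) := by
  rw [MulAut.mul_apply, transvection_of_ne h hr]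

lemma prefixLength_invLetter_lt (φ : MulAut (FreeGroup α)) (s : α × Bool) :
    2 * prefixLength φ (invLetter s) s < norm (φ (ofLetter s)) := by
  have h : φ (ofLetter s) ≠ 1 := fun h => (norm_map_ofLetter_pos φ s).ne' (norm_eq_zero.2 h)
  simpa [prefixLength] using two_mul_commonPrefixLength_inv_lt h

variable [Fintype α]

lemma sum_letters_lt {f g : α × Bool → ℕ} (t : α × Bool) (h : ∀ s, s.1 ≠ t.1 → f s = g s)
    (ht : f t + f (invLetter t) < g t + g (invLetter t)) : ∑ s, f s < ∑ s, g s := by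
  have key : ∀ k : α × Bool → ℕ, ∑ s, k s =
      (k t + k (invLetter t)) + ∑ a ∈ Finset.univ.erase t.1, (k (a, true) + k (a, false)) := by
    intro k
    obtain ⟨a, b⟩ := t
    rw [Fintype.sum_prod_type, ← Finset.add_sum_erase _ _ (Finset.mem_univ a)]
    cases b <;> simp [invLetter, add_comm]
  rw [key f, key g, Finset.sum_congr rfl fun a ha => by
    rw [h (a, true) (Finset.ne_of_mem_erase ha), h (a, false) (Finset.ne_of_mem_erase ha)]]
  omega

/-- The complexity of an automorphism: the total length of the images of the letters, refined by
the codes of their left halves. -/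
noncomputable def complexity (φ : MulAut (FreeGroup α)) : ℕ ×ₗ ℕ :=
  toLex (∑ s, norm (φ (ofLetter s)), ∑ s, halfCode (φ (ofLetter s)))

lemma complexity_lt_of_norm_lt (φ : MulAut (FreeGroup α)) {t s : α × Bool} (h : t.1 ≠ s.1)
    (hn : norm (φ (ofLetter s) * φ (ofLetter t)) < norm (φ (ofLetter t))) :
    complexity (φ * transvection t s h) < complexity φ := by
  refine Prod.Lex.toLex_lt_toLex.2 (Or.inl (sum_letters_lt t (fun r hr => ?_) ?_))
  · rw [mul_transvection_of_ne φ h hr]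
  · simp only [ofLetter_invLetter, _root_.map_inv, norm_inv_eq, mul_transvection_self]
    omega

lemma complexity_lt_of_halfCode_lt (φ : MulAut (FreeGroup α)) {t s : α × Bool} (h : t.1 ≠ s.1)
    (hn : norm (φ (ofLetter s) * φ (ofLetter t)) = norm (φ (ofLetter t)))
    (hc : halfCode (φ (ofLetter s) * φ (ofLetter t)) < halfCode (φ (ofLetter t)))
    (hi : halfCode (φ (ofLetter s) * φ (ofLetter t))⁻¹ = halfCode (φ (ofLetter t))⁻¹) :
    complexity (φ * transvection t s h) < complexity φ := by
  refine Prod.Lex.toLex_lt_toLex.2 (Or.inr ⟨Finset.sum_congr rfl fun r _ => ?_,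
    sum_letters_lt t (fun r hr => ?_) ?_⟩)
  · by_cases hr : r.1 = t.1
    · rcases eq_or_eq_invLetter hr with rfl | rfl
      · rw [mul_transvection_self, hn]
      · simp only [ofLetter_invLetter, _root_.map_inv, norm_inv_eq, mul_transvection_self, hn]
    · rw [mul_transvection_of_ne φ h hr]
  · rw [mul_transvection_of_ne φ h hr]
  · simp only [ofLetter_invLetter, _root_.map_inv, mul_transvection_self, hi]
    omega

/-- If exactly the first half of the image of `s` cancels against the image of `r`, and this half
has a larger code than the inverse of the other half, then a transvection lowers the
complexity. -/
lemma complexity_lt_of_half_cancellation (φ : MulAut (FreeGroup α)) {r s : α × Bool}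
    (hrs : r.1 ≠ s.1) {k : ℕ} (hk : prefixLength φ r s = k) (hs : norm (φ (ofLetter s)) = 2 * k)
    (hr : 2 * k ≤ norm (φ (ofLetter r)))
    (hc : ((φ (ofLetter s))⁻¹.toWord.take k).code < ((φ (ofLetter s)).toWord.take k).code) :
    complexity (φ * transvection r (invLetter s) hrs) < complexity φ := by
  obtain ⟨p, a, b, h1, h2, hp, -⟩ :=
    (φ (ofLetter r)).toWord.exists_eq_append_of_commonPrefixLength (φ (ofLetter s)).toWord
  change p.length = prefixLength φ r s at hp
  rw [hk] at hp
  have hb : (invRev b).length = p.length := by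
    rw [norm, h2, List.length_append] at hs
    rw [invRev_length]
    omega
  have ha : p.length ≤ a.length := by
    rw [norm, h1, List.length_append] at hr
    omega
  have hmul : φ (ofLetter (invLetter s)) * φ (ofLetter r) = FreeGroup.mk (invRev b ++ a) := by
    rw [ofLetter_invLetter, _root_.map_inv, ← mk_toWord (x := φ (ofLetter s)),
      ← mk_toWord (x := φ (ofLetter r)), h1, h2, ← mul_mk, ← mul_mk, ← mul_mk, ← inv_mk]
    group
  have hn : norm (φ (ofLetter (invLetter s)) * φ (ofLetter r)) = norm (φ (ofLetter r)) := by
    have := norm_inv_mul (φ (ofLetter s)) (φ (ofLetter r))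
    change _ + 2 * prefixLength φ s r = _ at this
    rw [prefixLength_comm, hk, hs] at this
    rw [ofLetter_invLetter, _root_.map_inv]
    omega
  have hword : (φ (ofLetter (invLetter s)) * φ (ofLetter r)).toWord = invRev b ++ a := by
    have h3 : (invRev b ++ a).length = norm (φ (ofLetter r)) := by
      rw [norm, h1, List.length_append, List.length_append, hb]
    rw [hmul, toWord_mk]
    refine reduce.red.sublist.eq_of_length ?_
    rw [h3, ← hn, hmul, norm, toWord_mk]
  have hc' : (invRev b).code < p.code := by
    rwa [toWord_inv, h2, invRev_append, ← hp, List.take_left' rfl, List.take_left' hb] at hc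
  exact complexity_lt_of_halfCode_lt φ (s := invLetter s) hrs hn (halfCode_lt h1 hword hb ha hc')
    (halfCode_inv_eq h1 hword hb ha)

/-- An automorphism whose complexity is not lowered by any transvection is Nielsen reduced. -/
lemma isNielsenReduced_of_complexity_le (φ : MulAut (FreeGroup α))
    (hmin : ∀ (t s : α × Bool) (h : t.1 ≠ s.1),
      complexity φ ≤ complexity (φ * transvection t s h)) :
    IsNielsenReduced φ := by
  have h1 : ∀ ⦃s t⦄, s ≠ t → 2 * prefixLength φ s t ≤ norm (φ (ofLetter s)) := by
    intro s t hst
    by_contra! hlt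
    have hts : t.1 ≠ s.1 := by
      intro h
      rcases eq_or_eq_invLetter h with rfl | rfl
      · exact hst rfl
      · have := prefixLength_invLetter_lt φ s
        rw [prefixLength_comm] at this
        omega
    refine (hmin t (invLetter s) hts).not_gt (complexity_lt_of_norm_lt φ _ ?_)
    have := norm_inv_mul (φ (ofLetter s)) (φ (ofLetter t))
    change _ + 2 * prefixLength φ s t = _ at this
    rw [ofLetter_invLetter, _root_.map_inv]
    omega
  refine ⟨h1, fun r s t hrs hts => ?_⟩
  by_contra! hle
  have hnorm : norm (φ (ofLetter (invLetter s))) = norm (φ (ofLetter s)) := by simp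
  have hr := h1 hrs
  have hr' := h1 hrs.symm
  have ht := h1 hts
  have ht' := h1 hts.symm
  rw [prefixLength_comm] at hr' ht
  obtain ⟨k, hk⟩ : ∃ k, prefixLength φ r s = k := ⟨_, rfl⟩
  have hk' : prefixLength φ t (invLetter s) = k := by
    rw [prefixLength_comm] at ht ⊢
    omega
  have hs : norm (φ (ofLetter s)) = 2 * k := by
    rw [prefixLength_comm] at hk'
    omega
  have hrs' : r.1 ≠ s.1 := by
    intro h
    rcases eq_or_eq_invLetter h with rfl | rfl
    · exact hrs rfl
    · have := prefixLength_invLetter_lt φ s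
      omega
  have hts' : t.1 ≠ (invLetter s).1 := by
    intro h
    rcases eq_or_eq_invLetter h with rfl | rfl
    · exact hts rfl
    · have := prefixLength_invLetter_lt φ (invLetter s)
      omega
  rcases lt_trichotomy ((φ (ofLetter s))⁻¹.toWord.take k).code
    ((φ (ofLetter s)).toWord.take k).code with hc | hc | hc
  · exact (hmin _ _ _).not_gt
      (complexity_lt_of_half_cancellation φ hrs' hk hs (by omega) hc)
  · have hlen : (φ (ofLetter s)).toWord.length = 2 * k := hs
    have hlen' : (φ (ofLetter s))⁻¹.toWord.length = 2 * k := by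
      rw [toWord_inv, invRev_length, hlen]
    have heq := List.code_injective_of_length_eq (by simp [hlen]) hc
    have hpos := norm_map_ofLetter_pos φ s
    have hlt := two_mul_commonPrefixLength_inv_lt (u := φ (ofLetter s))
      fun h => hpos.ne' (norm_eq_zero.2 h)
    have hge : k ≤ (φ (ofLetter s))⁻¹.toWord.commonPrefixLength (φ (ofLetter s)).toWord :=
      List.le_commonPrefixLength (by omega) heq
    omega
  · refine (hmin _ _ _).not_gt
      (complexity_lt_of_half_cancellation φ hts' hk' (by omega) (by omega) ?_)
    simpa using hc

end Descent

section Generation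

variable {α : Type*} [Finite α] [DecidableEq α] {N : Subgroup (MulAut (FreeGroup α))}

lemma signChange_mem (hinv : ∀ i, inversion i ∈ N) (ε : α → Bool) : signChange ε ∈ N := by
  have := Fintype.ofFinite α
  have key : ∀ T : Finset α, signChange (fun a => decide (a ∉ T)) ∈ N := by
    intro T
    induction T using Finset.induction_on with
    | empty =>
      convert! N.one_mem
      refine mulAut_ext fun a => ⟨true, ?_⟩
      rw [signChange_ofLetter]
      simp
    | insert i T hi ih =>
      convert! N.mul_mem (hinv i) ih
      refine mulAut_ext fun a => ⟨true, ?_⟩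
      rw [MulAut.mul_apply, inversion, signChange_ofLetter, signChange_ofLetter,
        signChange_ofLetter]
      by_cases h1 : a = i <;> by_cases h2 : a ∈ T <;> simp_all
  convert! key (Finset.univ.filter fun a => ε a = false)
  simp

/-- A generating criterion based on a normal form for automorphisms permuting the letters. -/
lemma mem_of_forall_exists_ofLetter (hperm : ∀ σ, permAut σ ∈ N) (hinv : ∀ i, inversion i ∈ N)
    {φ : MulAut (FreeGroup α)} (hφ : ∀ a, ∃ s, φ (of a) = ofLetter s) : φ ∈ N := by
  choose s hs using hφ
  have hinj : Function.Injective fun a => (s a).1 := by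
    intro a b hab
    rcases eq_or_eq_invLetter hab with h | h
    · exact of_injective (φ.injective (by rw [hs, hs, h]))
    · have h1 : φ (of a) = φ (of b)⁻¹ := by rw [_root_.map_inv, hs, hs, h, ofLetter_invLetter]
      have h2 := ofLetter_injective (a₁ := (a, true)) (a₂ := (b, false)) (φ.injective h1)
      exact (Prod.ext_iff.1 h2).1
  let σ := Equiv.ofBijective _ (Finite.injective_iff_bijective.1 hinj)
  have h : φ = permAut σ * signChange fun a => (s a).2 := by
    refine mulAut_ext fun a => ⟨true, ?_⟩
    rw [MulAut.mul_apply, signChange_ofLetter, permAut_ofLetter, ofLetter_true, hs]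
    simp [σ]
  rw [h]
  exact N.mul_mem (hperm σ) (signChange_mem hinv _)

/-- **Nielsen's theorem**: the automorphism group of a free group of finite rank is generated by
permutations and inversions of the generators and transvections. -/
theorem eq_top_of_elementary_mem (hperm : ∀ σ, permAut σ ∈ N) (hinv : ∀ i, inversion i ∈ N)
    (htrans : ∀ (t s : α × Bool) (h : t.1 ≠ s.1), transvection t s h ∈ N) : N = ⊤ := by
  have := Fintype.ofFinite α
  refine (Subgroup.eq_top_iff' N).2 fun φ => ?_
  induction hc : complexity φ using WellFoundedLT.induction generalizing φ with
  | ind c ih =>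
    by_cases hmin : ∀ (t s : α × Bool) (h : t.1 ≠ s.1),
        complexity φ ≤ complexity (φ * transvection t s h)
    · have hφ := isNielsenReduced_of_complexity_le φ hmin
      rw [← N.inv_mem_iff]
      exact mem_of_forall_exists_ofLetter hperm hinv hφ.exists_inv_apply_eq
    · push Not at hmin
      obtain ⟨t, s, h, hlt⟩ := hmin
      rw [← N.mul_mem_cancel_right (htrans t s h)]
      exact ih _ (hc ▸ hlt) _ rfl

end Generation

end FreeGroup

/-! ### Relations between elementary automorphisms -/

namespace FreeGroup

variable {α : Type*} [DecidableEq α]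

lemma permAut_conj_transvection (σ : Equiv.Perm α) {t s : α × Bool} (h : t.1 ≠ s.1) :
    permAut σ * transvection t s h * (permAut σ)⁻¹ =
      transvection (σ t.1, t.2) (σ s.1, s.2) (σ.injective.ne h) := by
  rw [mul_inv_eq_iff_eq_mul]
  refine mulAut_ext fun a => ?_
  by_cases ha : a = t.1
  · subst ha
    refine ⟨t.2, ?_⟩
    rw [MulAut.mul_apply, MulAut.mul_apply, transvection_self h, _root_.map_mul,
      permAut_ofLetter, permAut_ofLetter, transvection_self]
  · refine ⟨true, ?_⟩
    rw [MulAut.mul_apply, MulAut.mul_apply, transvection_of_ne h ha, permAut_ofLetter,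
      transvection_of_ne _ (σ.injective.ne ha)]

lemma inversion_conj_transvection_target {t s : α × Bool} (h : t.1 ≠ s.1)
    (h' : (invLetter t).1 ≠ s.1) :
    inversion t.1 * transvection t s h * (inversion t.1)⁻¹ = transvection (invLetter t) s h' := by
  rw [mul_inv_eq_iff_eq_mul]
  refine mulAut_ext fun a => ?_
  by_cases ha : a = t.1
  · subst ha
    refine ⟨t.2, ?_⟩
    have h1 : inversion t.1 (ofLetter t) = ofLetter (invLetter t) := inversion_ofLetter_self _ _
    rw [MulAut.mul_apply, MulAut.mul_apply, transvection_self h, _root_.map_mul,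
      inversion_ofLetter_of_ne h.symm, h1, transvection_self]
  · refine ⟨true, ?_⟩
    rw [MulAut.mul_apply, MulAut.mul_apply, transvection_of_ne h ha,
      inversion_ofLetter_of_ne ha, transvection_of_ne h' ha]

lemma inversion_conj_transvection_source {t s : α × Bool} (h : t.1 ≠ s.1)
    (h' : t.1 ≠ (invLetter s).1) :
    inversion s.1 * transvection t s h * (inversion s.1)⁻¹ = transvection t (invLetter s) h' := by
  rw [mul_inv_eq_iff_eq_mul]
  refine mulAut_ext fun a => ?_
  have h1 : inversion s.1 (ofLetter s) = ofLetter (invLetter s) := inversion_ofLetter_self _ _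
  by_cases ha : a = t.1
  · subst ha
    refine ⟨t.2, ?_⟩
    rw [MulAut.mul_apply, MulAut.mul_apply, transvection_self h, _root_.map_mul,
      inversion_ofLetter_of_ne h, h1, transvection_self]
  · by_cases hs : a = s.1
    · subst hs
      refine ⟨s.2, ?_⟩
      rw [MulAut.mul_apply, MulAut.mul_apply, transvection_of_ne h ha, h1,
        transvection_of_ne h' (r := invLetter s) ha]
    · refine ⟨true, ?_⟩
      rw [MulAut.mul_apply, MulAut.mul_apply, transvection_of_ne h ha,
        inversion_ofLetter_of_ne hs, transvection_of_ne h' ha]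

lemma transvection_mul_transvection {r s t : α × Bool} (hrs : r.1 ≠ s.1) (hst : s.1 ≠ t.1)
    (hrt : r.1 ≠ t.1) :
    transvection s t hst * transvection r s hrs =
      transvection r s hrs * transvection r t hrt * transvection s t hst := by
  refine mulAut_ext fun a => ?_
  by_cases ha : a = r.1
  · subst ha
    refine ⟨r.2, ?_⟩
    simp [transvection_self, transvection_of_ne, hrs, hrt.symm, mul_assoc]
  · by_cases hs : a = s.1
    · subst hs
      refine ⟨s.2, ?_⟩
      simp [transvection_self, transvection_of_ne, ha, hrt.symm]
    · refine ⟨true, ?_⟩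
      simp [transvection_of_ne, ha, hs]

lemma permAut_swap_mul_inversion {i j : α} (h : i ≠ j) :
    permAut (Equiv.swap i j) * inversion j =
      transvection (i, true) (j, true) h * transvection (j, true) (i, false) h.symm *
        transvection (i, false) (j, false) h := by
  have hf : ∀ a : α, ofLetter (a, false) = (ofLetter (a, true))⁻¹ := fun _ => rfl
  refine mulAut_ext fun a => ?_
  by_cases hi : a = i
  · subst hi
    refine ⟨false, ?_⟩
    rw [MulAut.mul_apply, inversion_ofLetter_of_ne h, permAut_ofLetter]
    simp only [MulAut.mul_apply, transvection_self, _root_.map_mul, Equiv.swap_apply_left]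
    rw [hf j, _root_.map_inv, transvection_self, transvection_of_ne _ h]
    simp only [_root_.map_mul, _root_.map_inv]
    rw [transvection_of_ne (r := (j, true)) h h.symm]
    group
  · by_cases hj : a = j
    · subst hj
      refine ⟨true, ?_⟩
      rw [MulAut.mul_apply, inversion_ofLetter_self, permAut_ofLetter, MulAut.mul_apply,
        MulAut.mul_apply, transvection_of_ne _ h.symm, transvection_self, _root_.map_mul, hf i,
        _root_.map_inv, transvection_self, transvection_of_ne _ h.symm]
      simp [hf i]
    · refine ⟨true, ?_⟩
      simp [permAut_ofLetter, inversion_ofLetter_of_ne, transvection_of_ne, hi, hj,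
        Equiv.swap_apply_of_ne_of_ne]

section Representation

variable {G : Type*} [Group G] {ρ : MulAut (FreeGroup α) →* G}

lemma map_transvection_eq_of_mem_ker {σ : Equiv.Perm α} (hσ : ρ (permAut σ) = 1)
    {t s : α × Bool} (h : t.1 ≠ s.1) :
    ρ (transvection (σ t.1, t.2) (σ s.1, s.2) (σ.injective.ne h)) = ρ (transvection t s h) := by
  rw [← permAut_conj_transvection σ h, _root_.map_mul, _root_.map_mul, _root_.map_inv, hσ]
  simp

lemma map_transvection_eq_one_iff_invLetter {t s : α × Bool} (h : t.1 ≠ s.1) :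
    (ρ (transvection (invLetter t) s h) = 1 ↔ ρ (transvection t s h) = 1) ∧
      (ρ (transvection t (invLetter s) h) = 1 ↔ ρ (transvection t s h) = 1) := by
  rw [← inversion_conj_transvection_target h h, ← inversion_conj_transvection_source h h]
  simp

variable [Fintype α]

lemma map_transvection_true_eq_one (hα : 4 ≤ Fintype.card α)
    (hρ : ∀ σ ∈ alternatingGroup α, ρ (permAut σ) = 1) {i j : α} (h : i ≠ j) :
    ρ (transvection (i, true) (j, true) h) = 1 := by
  obtain ⟨k, hk⟩ := Finset.exists_mem_notMem_of_card_lt_card (s := {i, j}) (t := Finset.univ)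
    (Finset.card_le_two.trans_lt (by rw [Finset.card_univ]; omega))
  obtain ⟨l, hl⟩ := Finset.exists_mem_notMem_of_card_lt_card (s := {i, j, k}) (t := Finset.univ)
    (Finset.card_le_three.trans_lt (by rw [Finset.card_univ]; omega))
  simp only [Finset.mem_univ, Finset.mem_insert, Finset.mem_singleton, true_and, not_or] at hk hl
  obtain ⟨hik, hjk⟩ : i ≠ k ∧ j ≠ k := ⟨Ne.symm hk.1, Ne.symm hk.2⟩
  obtain ⟨hil, hjl, hkl⟩ : i ≠ l ∧ j ≠ l ∧ k ≠ l :=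
    ⟨Ne.symm hl.1, Ne.symm hl.2.1, Ne.symm hl.2.2⟩
  have even : ∀ {a b c d : α}, a ≠ b → c ≠ d →
      Equiv.swap a b * Equiv.swap c d ∈ alternatingGroup α := by
    intro a b c d hab hcd
    rw [Equiv.Perm.mem_alternatingGroup, _root_.map_mul, Equiv.Perm.sign_swap hab,
      Equiv.Perm.sign_swap hcd]
    rfl
  have h1 : ρ (transvection (j, true) (k, true) hjk) = ρ (transvection (i, true) (j, true) h) := by
    simpa [Equiv.swap_apply_of_ne_of_ne, h, hik, hik.symm, hjk.symm] using
      map_transvection_eq_of_mem_ker (hρ _ (even h hjk)) (t := (i, true)) (s := (j, true)) h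
  have h2 : ρ (transvection (i, true) (k, true) hik) = ρ (transvection (i, true) (j, true) h) := by
    simpa [Equiv.swap_apply_of_ne_of_ne, h, hik, hil, hjk, hjl] using
      map_transvection_eq_of_mem_ker (hρ _ (even hjk hkl)) (t := (i, true)) (s := (j, true)) h
  have h3 := congrArg ρ (transvection_mul_transvection (r := (i, true)) (s := (j, true))
    (t := (k, true)) h hjk hik)
  simpa [h1, h2] using h3

/-- A homomorphism killing the even permutations of the generators kills all transvections. -/
lemma map_transvection_eq_one (hα : 4 ≤ Fintype.card α)
    (hρ : ∀ σ ∈ alternatingGroup α, ρ (permAut σ) = 1) (t s : α × Bool) (h : t.1 ≠ s.1) :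
    ρ (transvection t s h) = 1 := by
  obtain ⟨i, b⟩ := t
  obtain ⟨j, c⟩ := s
  have h1 : ρ (transvection (i, true) (j, true) h) = 1 := map_transvection_true_eq_one hα hρ h
  have h2 : ρ (transvection (i, b) (j, true) h) = 1 := by
    cases b
    · exact (map_transvection_eq_one_iff_invLetter (t := (i, true)) (s := (j, true)) h).1.2 h1
    · exact h1
  cases c
  · exact (map_transvection_eq_one_iff_invLetter (t := (i, b)) (s := (j, true)) h).2.2 h2
  · exact h2

/-- A homomorphism killing the even permutations of the generators has image of order at
most two. -/
theorem index_ker_dvd_two (hα : 4 ≤ Fintype.card α)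
    (hρ : ∀ σ ∈ alternatingGroup α, ρ (permAut σ) = 1) : ρ.ker.index ∣ 2 := by
  obtain ⟨i, j, hij⟩ := Fintype.one_lt_card_iff.1 (by omega : 1 < Fintype.card α)
  let e := ρ (permAut (Equiv.swap i j))
  have he : e ^ 2 = 1 := by
    rw [← _root_.map_pow, ← _root_.map_pow, pow_two, Equiv.swap_mul_self, _root_.map_one,
      _root_.map_one]
  have hperm : ∀ σ : Equiv.Perm α, ρ (permAut σ) ∈ Subgroup.zpowers e := by
    intro σ
    rcases Int.units_eq_one_or (Equiv.Perm.sign σ) with hσ | hσ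
    · rw [hρ σ (Equiv.Perm.mem_alternatingGroup.2 hσ)]
      exact one_mem _
    · have : ρ (permAut (σ * Equiv.swap i j)) = 1 := hρ _ <| by
        rw [Equiv.Perm.mem_alternatingGroup, _root_.map_mul, hσ, Equiv.Perm.sign_swap hij]
        rfl
      rw [_root_.map_mul, _root_.map_mul, mul_eq_one_iff_eq_inv] at this
      rw [this]
      exact inv_mem (Subgroup.mem_zpowers e)
  have htrans := map_transvection_eq_one hα hρ
  have hinv : ∀ k, ρ (inversion k) ∈ Subgroup.zpowers e := by
    intro k
    obtain ⟨l, hl⟩ := Fintype.exists_ne_of_one_lt_card (by omega : 1 < Fintype.card α) k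
    have h := congrArg ρ (permAut_swap_mul_inversion hl)
    rw [_root_.map_mul, _root_.map_mul, _root_.map_mul, htrans, htrans, htrans, mul_one, mul_one,
      mul_eq_one_iff_inv_eq] at h
    rw [← h]
    exact inv_mem (hperm _)
  have htop : (Subgroup.zpowers e).comap ρ = ⊤ :=
    eq_top_of_elementary_mem hperm hinv fun t s h => by
      rw [Subgroup.mem_comap, htrans]
      exact one_mem _
  have hrange : ρ.range ≤ Subgroup.zpowers e := by
    rintro _ ⟨φ, rfl⟩
    exact Subgroup.mem_comap.1 (htop ▸ Subgroup.mem_top φ)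
  rw [Subgroup.index_ker]
  refine (Subgroup.card_dvd_of_le hrange).trans ?_
  rw [Nat.card_zpowers]
  exact orderOf_dvd_of_pow_eq_one he

end Representation

end FreeGroup

/-- **Theorem.** For `n ≥ 6`, any `C¹` action of `Aut(Fₙ)` on the circle factors
through an action of `ℤ/2ℤ`: its kernel has index `1` or `2`. -/
theorem c1_action_of_autFreeGroup_factors_through_Z2
    {n : ℕ} (hn : 6 ≤ n)
    (ρ : MulAut (FreeGroup (Fin n)) →* (UnitAddCircle ≃ₜ UnitAddCircle))
    (hρ : IsC1Action ρ) :
    (MonoidHom.ker ρ).index = 1 ∨ (MonoidHom.ker ρ).index = 2 := by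
  have hρ' : IsC1Action (ρ.comp FreeGroup.permAut) := fun σ => hρ (FreeGroup.permAut σ)
  refine (Nat.dvd_prime Nat.prime_two).1 (FreeGroup.index_ker_dvd_two ?_ fun σ hσ => ?_)
  · rw [Fintype.card_fin]
    omega
  · refine hρ'.map_eq_one_of_mem_alternatingGroup ?_ hσ
    rw [Nat.card_eq_fintype_card, Fintype.card_fin]
    omega
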